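/- Let m be a positive integer and let L0 and L1 be real symmetric 5m×5m matrices such that for every t ∈ ℝ the matrix L(t) := cos(t)·L0 + sin(t)·L1 has eigenvalues exactly −√3, −1/√3, 0, 1/√3, √3, each with multiplicity m. Then the following are equivalent: (i) ker L(t) is independent of t, i.e. ker L(t) = ker L(0) for all t ∈ ℝ; (ii) dim E = m; (iii) L(t)·x = 0 for every t ∈ ℝ and every x ∈ E; (iv) L_+·x = 0 for every x in the complexification of E; (v) L_+·P_i = 0 for all i ∈ {−4, −2, 0, 2, 4}. -/

import Mathlib

open Matrix

noncomputable section

/-- `L₊ = ½(L0 - i·L1)`, viewed as a complex matrix. -/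
def Lplus {n : ℕ} (L0 L1 : Matrix (Fin n) (Fin n) ℝ) : Matrix (Fin n) (Fin n) ℂ :=
  (1 / 2 : ℂ) • (L0.map Complex.ofReal - Complex.I • L1.map Complex.ofReal)

/-- `L₋ = ½(L0 + i·L1)`, viewed as a complex matrix. -/
def Lminus {n : ℕ} (L0 L1 : Matrix (Fin n) (Fin n) ℝ) : Matrix (Fin n) (Fin n) ℂ :=
  (1 / 2 : ℂ) • (L0.map Complex.ofReal + Complex.I • L1.map Complex.ofReal)

/-- `σ(A³B)`: the average of all words consisting of three factors `A` and one factor `B`. -/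
def word31 {n : ℕ} (A B : Matrix (Fin n) (Fin n) ℂ) : Matrix (Fin n) (Fin n) ℂ :=
  (1 / 4 : ℂ) • (A ^ 3 * B + A ^ 2 * B * A + A * B * A ^ 2 + B * A ^ 3)

/-- `σ(A²B²)`: the average of all words consisting of two factors `A` and two factors `B`. -/
def word22 {n : ℕ} (A B : Matrix (Fin n) (Fin n) ℂ) : Matrix (Fin n) (Fin n) ℂ :=
  (1 / 6 : ℂ) •
    (A * A * B * B + A * B * A * B + A * B * B * A + B * A * A * B + B * A * B * A +
      B * B * A * A)

/-- `σ(AB)`: the average of the two words consisting of one factor `A` and one factor `B`. -/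
def word11 {n : ℕ} (A B : Matrix (Fin n) (Fin n) ℂ) : Matrix (Fin n) (Fin n) ℂ :=
  (1 / 2 : ℂ) • (A * B + B * A)

/-- `P₄ := L₊⁴`. -/
def Pfour {n : ℕ} (L0 L1 : Matrix (Fin n) (Fin n) ℝ) : Matrix (Fin n) (Fin n) ℂ :=
  Lplus L0 L1 ^ 4

/-- `P₂ := 4·σ(L₊³L₋) - (10/3)·L₊²`. -/
def Ptwo {n : ℕ} (L0 L1 : Matrix (Fin n) (Fin n) ℝ) : Matrix (Fin n) (Fin n) ℂ :=
  (4 : ℂ) • word31 (Lplus L0 L1) (Lminus L0 L1) - (10 / 3 : ℂ) • Lplus L0 L1 ^ 2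

/-- `P₀ := 6·σ(L₊²L₋²) - (20/3)·σ(L₊L₋) + 1`. -/
def Pzero {n : ℕ} (L0 L1 : Matrix (Fin n) (Fin n) ℝ) : Matrix (Fin n) (Fin n) ℂ :=
  (6 : ℂ) • word22 (Lplus L0 L1) (Lminus L0 L1) -
    (20 / 3 : ℂ) • word11 (Lplus L0 L1) (Lminus L0 L1) + 1


/-- `P₋₂ :=` the complex conjugate of `P₂`. -/
def Pmtwo {n : ℕ} (L0 L1 : Matrix (Fin n) (Fin n) ℝ) : Matrix (Fin n) (Fin n) ℂ :=
  (Ptwo L0 L1).map (starRingEnd ℂ)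

/-- `P₋₄ :=` the complex conjugate of `P₄`. -/
def Pmfour {n : ℕ} (L0 L1 : Matrix (Fin n) (Fin n) ℝ) : Matrix (Fin n) (Fin n) ℂ :=
  (Pfour L0 L1).map (starRingEnd ℂ)

/-- The family `L(t) = cos(t)·L0 + sin(t)·L1`. -/
def Lfam {n : ℕ} (L0 L1 : Matrix (Fin n) (Fin n) ℝ) (t : ℝ) : Matrix (Fin n) (Fin n) ℝ :=
  Real.cos t • L0 + Real.sin t • L1

/-- `E`: the real subspace of `ℝ^{5m}` spanned by the kernels `ker L(t)`, `t ∈ ℝ`. -/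
def Espan {n : ℕ} (L0 L1 : Matrix (Fin n) (Fin n) ℝ) : Submodule ℝ (Fin n → ℝ) :=
  ⨆ t : ℝ, LinearMap.ker (Lfam L0 L1 t).mulVecLin

/-- The complexification of `E`: the complex span of the image of `E` in `ℂ^{5m}`. -/
def EspanC {n : ℕ} (L0 L1 : Matrix (Fin n) (Fin n) ℝ) : Submodule ℂ (Fin n → ℂ) :=
  Submodule.span ℂ ((fun x : Fin n → ℝ => fun i => (x i : ℂ)) '' (Espan L0 L1 : Set (Fin n → ℝ)))

section

variable {n : ℕ} {L0 L1 : Matrix (Fin n) (Fin n) ℝ}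

/-- A nilpotent real symmetric matrix vanishes. -/
theorem Matrix.IsSymm.eq_zero_of_pow_eq_zero {N : Matrix (Fin n) (Fin n) ℝ} (hN : N.IsSymm)
    {k : ℕ} (hk : N ^ k = 0) : N = 0 := by
  have key : ∀ j : ℕ, N ^ 2 ^ j = 0 → N = 0 := by
    intro j
    induction j with
    | zero => intro h; simpa using h
    | succ j ih =>
      intro h
      refine ih (Matrix.conjTranspose_mul_self_eq_zero.mp ?_)
      rw [Matrix.conjTranspose_eq_transpose_of_trivial, Matrix.transpose_pow, hN.eq, ← pow_add,
        ← two_mul, ← pow_succ']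
      exact h
  exact key k (pow_eq_zero_of_le k.lt_two_pow_self.le hk)

/-- The polynomial `(X² - 3)(X² - 1/3)` evaluated at a real matrix. For a symmetric matrix with
spectrum `{-√3, -1/√3, 0, 1/√3, √3}` this is the orthogonal projection onto the kernel. -/
def kerProj (A : Matrix (Fin n) (Fin n) ℝ) : Matrix (Fin n) (Fin n) ℝ :=
  A ^ 4 - (10 / 3 : ℝ) • A ^ 2 + 1

theorem mul_kerProj_eq_zero {A : Matrix (Fin n) (Fin n) ℝ} (hA : A.IsSymm) {m : ℕ}
    (h : A.charpoly = (Polynomial.X ^ 2 - Polynomial.C 3) ^ m *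
        (Polynomial.X ^ 2 - Polynomial.C (1 / 3 : ℝ)) ^ m * Polynomial.X ^ m) :
    A * kerProj A = 0 := by
  have hfac : A * kerProj A = Polynomial.aeval A ((Polynomial.X ^ 2 - Polynomial.C 3) *
      (Polynomial.X ^ 2 - Polynomial.C (1 / 3 : ℝ)) * Polynomial.X) := by
    have hp : ((Polynomial.X ^ 2 - Polynomial.C 3) *
      (Polynomial.X ^ 2 - Polynomial.C (1 / 3 : ℝ)) * Polynomial.X) =
      Polynomial.X * (Polynomial.X ^ 4 - Polynomial.C (10 / 3 : ℝ) * Polynomial.X ^ 2 + 1) := by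
      have h1 : (Polynomial.C (10 / 3 : ℝ)) = Polynomial.C 3 + Polynomial.C (1 / 3) := by
        rw [← Polynomial.C_add]; norm_num
      have h2 : (Polynomial.C 3 : Polynomial ℝ) * Polynomial.C (1 / 3) = 1 := by
        rw [← Polynomial.C_mul]; norm_num
      rw [h1]
      linear_combination Polynomial.X * h2
    rw [hp]
    simp [kerProj, Algebra.smul_def]
  have hsymm : (A * kerProj A).IsSymm := by
    have hc : Commute A (kerProj A) :=
      (((Commute.refl A).pow_right 4).sub_right
        (((Commute.refl A).pow_right 2).smul_right _)).add_right (Commute.one_right A)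
    have hk : (kerProj A)ᵀ = kerProj A := by
      simp [kerProj, Matrix.transpose_pow, hA.eq]
    rw [Matrix.IsSymm, Matrix.transpose_mul, hk, hA.eq, hc.eq]
  refine hsymm.eq_zero_of_pow_eq_zero (k := m) ?_
  rw [hfac, ← map_pow, mul_pow, mul_pow, ← h, Matrix.aeval_self_charpoly]

theorem kerProj_mulVec_of_mulVec_eq_zero {A : Matrix (Fin n) (Fin n) ℝ} {x : Fin n → ℝ}
    (hx : A *ᵥ x = 0) : kerProj A *ᵥ x = x := by
  simp [kerProj, Matrix.add_mulVec, Matrix.sub_mulVec, Matrix.smul_mulVec, pow_succ,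
    ← Matrix.mulVec_mulVec, hx]

theorem finrank_ker_eq_rootMultiplicity {A : Matrix (Fin n) (Fin n) ℝ} (hA : A.IsSymm) :
    Module.finrank ℝ (LinearMap.ker A.mulVecLin) = A.charpoly.rootMultiplicity 0 := by
  have hH : A.IsHermitian := by
    rw [Matrix.IsHermitian, Matrix.conjTranspose_eq_transpose_of_trivial, hA.eq]
  have hrn := LinearMap.finrank_range_add_finrank_ker A.mulVecLin
  have hr : Module.finrank ℝ (LinearMap.range A.mulVecLin) = _ := hH.rank_eq_card_non_zero_eigs
  have hroot : A.charpoly.rootMultiplicity 0 = Fintype.card {i // hH.eigenvalues i = 0} := by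
    rw [← Polynomial.count_roots, hH.roots_charpoly_eq_eigenvalues, Multiset.count_map,
      Fintype.card_subtype]
    simp [Finset.card_def, eq_comm]
  have hc := Fintype.card_subtype_compl (fun i => hH.eigenvalues i = 0)
  have hle := Fintype.card_subtype_le (fun i => hH.eigenvalues i = 0)
  simp only [Module.finrank_fintype_fun_eq_card, Fintype.card_fin] at hrn hc hle
  rw [hr] at hrn
  simp only [ne_eq] at hrn
  omega

theorem rootMultiplicity_zero_charpoly (m : ℕ) :
    ((Polynomial.X ^ 2 - Polynomial.C 3) ^ m * (Polynomial.X ^ 2 - Polynomial.C (1 / 3 : ℝ)) ^ m *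
      Polynomial.X ^ m).rootMultiplicity 0 = m := by
  have h := Polynomial.rootMultiplicity_mul_X_sub_C_pow (R := ℝ) (a := 0) (n := m)
    (p := (Polynomial.X ^ 2 - Polynomial.C 3) ^ m *
      (Polynomial.X ^ 2 - Polynomial.C (1 / 3 : ℝ)) ^ m) (by
        intro h
        have := congrArg (Polynomial.eval 0) h
        simp at this)
  rw [Polynomial.C_0, sub_zero] at h
  rw [h, Polynomial.rootMultiplicity_eq_zero, zero_add]
  simp [Polynomial.IsRoot]

theorem isSymm_Lfam (h0 : L0.IsSymm) (h1 : L1.IsSymm) (t : ℝ) : (Lfam L0 L1 t).IsSymm :=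
  (h0.smul _).add (h1.smul _)

theorem map_conj_Lplus : (Lplus L0 L1).map (starRingEnd ℂ) = Lminus L0 L1 := by
  ext i j
  simp [Lplus, Lminus, map_ofNat]

theorem map_conj_Lminus : (Lminus L0 L1).map (starRingEnd ℂ) = Lplus L0 L1 := by
  ext i j
  simp [Lplus, Lminus, map_ofNat]
  ring

theorem Pmfour_eq : Pmfour L0 L1 = Lminus L0 L1 ^ 4 := by
  rw [Pmfour, Pfour, ← map_conj_Lplus]
  exact map_pow (starRingEnd ℂ).mapMatrix _ _

theorem Pmtwo_eq : Pmtwo L0 L1 =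
    (4 : ℂ) • word31 (Lminus L0 L1) (Lplus L0 L1) - (10 / 3 : ℂ) • Lminus L0 L1 ^ 2 := by
  have hsmul : ∀ (c : ℂ) (M : Matrix (Fin n) (Fin n) ℂ), (starRingEnd ℂ).mapMatrix (c • M) =
      (starRingEnd ℂ c) • (starRingEnd ℂ).mapMatrix M := by
    intro c M; ext i j; simp
  have hp : (starRingEnd ℂ).mapMatrix (Lplus L0 L1) = Lminus L0 L1 := map_conj_Lplus
  have hm : (starRingEnd ℂ).mapMatrix (Lminus L0 L1) = Lplus L0 L1 := map_conj_Lminus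
  change (starRingEnd ℂ).mapMatrix (Ptwo L0 L1) = _
  simp only [Ptwo, word31, map_sub, map_add, map_mul, map_pow, hsmul, hp, hm]
  simp [map_ofNat]

theorem map_ofReal_Lfam (t : ℝ) : (Lfam L0 L1 t).map Complex.ofReal =
    Complex.exp (t * Complex.I) • Lplus L0 L1 +
      (Complex.exp (t * Complex.I))⁻¹ • Lminus L0 L1 := by
  ext i j
  rw [← Complex.exp_neg, ← neg_mul]
  simp only [Lfam, Lplus, Lminus, Matrix.map_apply, Matrix.add_apply, Matrix.smul_apply,
    Matrix.sub_apply, smul_eq_mul, Complex.exp_mul_I, Complex.cos_neg, Complex.sin_neg]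
  push_cast
  linear_combination (Complex.sin t * L1 i j) * Complex.I_sq

theorem map_ofReal_kerProj_Lfam (t : ℝ) :
    (kerProj (Lfam L0 L1 t)).map Complex.ofReal =
      ((Complex.exp (t * Complex.I)) ^ 4)⁻¹ • (Pmfour L0 L1 +
        Complex.exp (t * Complex.I) ^ 2 • Pmtwo L0 L1 +
        Complex.exp (t * Complex.I) ^ 4 • Pzero L0 L1 +
        Complex.exp (t * Complex.I) ^ 6 • Ptwo L0 L1 +
        Complex.exp (t * Complex.I) ^ 8 • Pfour L0 L1) := by
  have h : (kerProj (Lfam L0 L1 t)).map Complex.ofReal =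
      ((Lfam L0 L1 t).map Complex.ofReal) ^ 4 -
        (10 / 3 : ℂ) • ((Lfam L0 L1 t).map Complex.ofReal) ^ 2 + 1 := by
    have hs : ∀ M : Matrix (Fin n) (Fin n) ℝ, Complex.ofRealHom.mapMatrix ((10 / 3 : ℝ) • M) =
      (10 / 3 : ℂ) • Complex.ofRealHom.mapMatrix M := by
      intro M; ext i j; simp
    change Complex.ofRealHom.mapMatrix (kerProj (Lfam L0 L1 t)) =
      (Complex.ofRealHom.mapMatrix (Lfam L0 L1 t)) ^ 4 -
        (10 / 3 : ℂ) • (Complex.ofRealHom.mapMatrix (Lfam L0 L1 t)) ^ 2 + 1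
    simp only [kerProj, map_add, map_sub, map_pow, map_one, hs]
  have hu : Complex.exp (t * Complex.I) ≠ 0 := Complex.exp_ne_zero _
  rw [h, map_ofReal_Lfam, Pmfour_eq, Pmtwo_eq, Pzero, Ptwo, Pfour]
  generalize Complex.exp (t * Complex.I) = u at hu
  generalize Lplus L0 L1 = A
  generalize Lminus L0 L1 = B
  simp only [word31, word22, word11, pow_succ, pow_zero, one_mul, add_mul, mul_add,
    smul_mul_assoc, mul_smul_comm, mul_assoc]
  match_scalars <;> field_simp <;> ring

theorem infinite_exp_sq_mul_I :
    (Set.range fun t : ℝ => Complex.exp (t * Complex.I) ^ 2).Infinite := by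
  have hinj : Set.InjOn (fun t : ℝ => Complex.exp (t * Complex.I) ^ 2)
      (Set.Icc 0 (Real.pi / 2)) := by
    intro s hs t ht hst
    have hre : ∀ r : ℝ, (Complex.exp (r * Complex.I) ^ 2).re = Real.cos (2 * r) := by
      intro r
      rw [← Complex.exp_nat_mul, ← Complex.exp_ofReal_mul_I_re]
      push_cast
      ring_nf
    have hcos : Real.cos (2 * s) = Real.cos (2 * t) := by
      rw [← hre, ← hre]; exact congrArg Complex.re hst
    have := Real.injOn_cos (x₁ := 2 * s) (x₂ := 2 * t)
      ⟨by linarith [hs.1], by linarith [hs.2]⟩ ⟨by linarith [ht.1], by linarith [ht.2]⟩ hcos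
    linarith
  exact ((Set.Icc_infinite (by positivity)).image hinj).mono (Set.image_subset_range _ _)

/-- A quartic polynomial with matrix coefficients vanishing at infinitely many scalars is zero. -/
theorem matrix_coeffs_eq_zero_of_infinite {Q : Fin 5 → Matrix (Fin n) (Fin n) ℂ} {S : Set ℂ}
    (hS : S.Infinite) (h : ∀ w ∈ S, ∑ k : Fin 5, w ^ (k : ℕ) • Q k = 0) : ∀ k, Q k = 0 := by
  intro k
  ext i j
  set p : Polynomial ℂ := ∑ k : Fin 5, Polynomial.C (Q k i j) * Polynomial.X ^ (k : ℕ) with hp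
  have hp0 : p = 0 := by
    refine Polynomial.eq_zero_of_infinite_isRoot p (hS.mono fun w hw => ?_)
    have := congrFun (congrFun (h w hw) i) j
    simp only [Matrix.sum_apply, Matrix.smul_apply, smul_eq_mul, Matrix.zero_apply] at this
    simp only [Set.mem_ofPred_eq, Polynomial.IsRoot, hp, Polynomial.eval_finsetSum,
      Polynomial.eval_mul, Polynomial.eval_C, Polynomial.eval_pow, Polynomial.eval_X]
    simpa only [mul_comm] using this
  have hk : p.coeff k = Q k i j := by
    simp [hp, Polynomial.finsetSum_coeff, Polynomial.coeff_X_pow, Fin.val_inj]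
  rw [← hk, hp0]
  simp

theorem mul_coeffs_eq_zero_iff (M : Matrix (Fin n) (Fin n) ℂ) :
    (M * Pmfour L0 L1 = 0 ∧ M * Pmtwo L0 L1 = 0 ∧ M * Pzero L0 L1 = 0 ∧ M * Ptwo L0 L1 = 0 ∧
      M * Pfour L0 L1 = 0) ↔
      ∀ t : ℝ, M * (kerProj (Lfam L0 L1 t)).map Complex.ofReal = 0 := by
  constructor
  · rintro ⟨h1, h2, h3, h4, h5⟩ t
    simp [map_ofReal_kerProj_Lfam, mul_add, h1, h2, h3, h4, h5]
  · intro h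
    have hQ := matrix_coeffs_eq_zero_of_infinite (Q := ![M * Pmfour L0 L1, M * Pmtwo L0 L1,
      M * Pzero L0 L1, M * Ptwo L0 L1, M * Pfour L0 L1]) infinite_exp_sq_mul_I (by
        rintro _ ⟨t, rfl⟩
        have ht := h t
        rw [map_ofReal_kerProj_Lfam, Matrix.mul_smul, smul_eq_zero_iff_right
          (inv_ne_zero (pow_ne_zero _ (Complex.exp_ne_zero _)))] at ht
        simpa [Fin.sum_univ_succ, mul_add, ← pow_mul, add_assoc] using ht)
    exact ⟨hQ 0, hQ 1, hQ 2, hQ 3, hQ 4⟩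

theorem mulVec_ofReal_map (A : Matrix (Fin n) (Fin n) ℝ) (x : Fin n → ℝ) :
    A.map Complex.ofReal *ᵥ (fun i => (x i : ℂ)) = fun i => ((A *ᵥ x) i : ℂ) := by
  ext i
  simp [Matrix.mulVec, dotProduct]

theorem Lplus_mulVec_ofReal_eq_zero_iff (x : Fin n → ℝ) :
    Lplus L0 L1 *ᵥ (fun i => (x i : ℂ)) = 0 ↔ ∀ t, Lfam L0 L1 t *ᵥ x = 0 := by
  have h : Lplus L0 L1 *ᵥ (fun i => (x i : ℂ)) =
      fun i => (1 / 2 : ℂ) * (((L0 *ᵥ x) i : ℂ) - Complex.I * ((L1 *ᵥ x) i : ℂ)) := by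
    ext i
    simp [Lplus, Matrix.smul_mulVec, Matrix.sub_mulVec, mulVec_ofReal_map]
  rw [h]
  constructor
  · intro hx t
    have hi : ∀ i, (L0 *ᵥ x) i = 0 ∧ (L1 *ᵥ x) i = 0 := by
      intro i
      have := congrFun hx i
      simpa [Complex.ext_iff] using this
    ext i
    simp [Lfam, Matrix.add_mulVec, Matrix.smul_mulVec, hi i]
  · intro hx
    have e0 : L0 *ᵥ x = 0 := by simpa [Lfam] using hx 0
    have e1 : L1 *ᵥ x = 0 := by simpa [Lfam] using hx (Real.pi / 2)
    ext i
    simp [e0, e1]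

theorem ker_Lfam_le_Espan (t : ℝ) :
    LinearMap.ker (Lfam L0 L1 t).mulVecLin ≤ Espan L0 L1 :=
  le_iSup (fun t : ℝ => LinearMap.ker (Lfam L0 L1 t).mulVecLin) t

theorem forall_EspanC_iff :
    (∀ x ∈ EspanC L0 L1, Lplus L0 L1 *ᵥ x = 0) ↔
      ∀ x ∈ Espan L0 L1, Lplus L0 L1 *ᵥ (fun i => (x i : ℂ)) = 0 := by
  change EspanC L0 L1 ≤ LinearMap.ker (Lplus L0 L1).mulVecLin ↔ _
  rw [EspanC, Submodule.span_le, Set.image_subset_iff]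
  rfl

theorem forall_Espan_mulVec_iff (h : ∀ t, Lfam L0 L1 t * kerProj (Lfam L0 L1 t) = 0) :
    (∀ x ∈ Espan L0 L1, Lplus L0 L1 *ᵥ (fun i => (x i : ℂ)) = 0) ↔
      ∀ t : ℝ, Lplus L0 L1 * (kerProj (Lfam L0 L1 t)).map Complex.ofReal = 0 := by
  constructor
  · intro hE t
    refine Matrix.ext_of_mulVec_single fun j => ?_
    have hs : (Pi.single j 1 : Fin n → ℂ) = fun i => ((Pi.single j 1 : Fin n → ℝ) i : ℂ) := by
      ext i
      by_cases hij : i = j <;> simp [hij]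
    rw [hs, ← Matrix.mulVec_mulVec, mulVec_ofReal_map, Matrix.zero_mulVec]
    refine hE _ (ker_Lfam_le_Espan t ?_)
    rw [LinearMap.mem_ker, Matrix.mulVecLin_apply, Matrix.mulVec_mulVec, h t, Matrix.zero_mulVec]
  · intro hP x hx
    refine Submodule.iSup_induction _ (motive := fun x : Fin n → ℝ =>
      Lplus L0 L1 *ᵥ (fun i => (x i : ℂ)) = 0) hx ?_ ?_ ?_
    · intro t y hy
      have hy' : kerProj (Lfam L0 L1 t) *ᵥ y = y := kerProj_mulVec_of_mulVec_eq_zero hy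
      rw [← hy', ← mulVec_ofReal_map, Matrix.mulVec_mulVec, hP t, Matrix.zero_mulVec]
    · exact (congrArg _ (funext fun _ => Complex.ofReal_zero)).trans (Matrix.mulVec_zero _)
    · intro y z hy hz
      have : (fun i => ((y + z) i : ℂ)) = (fun i => (y i : ℂ)) + fun i => (z i : ℂ) := by
        ext i; simp
      rw [this, Matrix.mulVec_add, hy, hz, add_zero]

end

/-- for an isospectral family `L(t) = cos(t)·L0 + sin(t)·L1` of real symmetric
`5m × 5m` matrices with spectrum `{-√3, -1/√3, 0, 1/√3, √3}` (each eigenvalue of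
multiplicity `m`), the following are equivalent:
(i) `ker L(t)` is constant in `t`; (ii) `dim E = m`; (iii) `L(t)·x = 0` for every `t` and
every `x ∈ E`; (iv) `L₊·x = 0` for every `x` in the complexification of `E`;
(v) `L₊·Pᵢ = 0` for all `i ∈ {-4, -2, 0, 2, 4}`. -/
theorem statement5 (m : ℕ) (hm : 0 < m)
    (L0 L1 : Matrix (Fin (5 * m)) (Fin (5 * m)) ℝ)
    (h0 : L0.IsSymm) (h1 : L1.IsSymm)
    (hiso : ∀ t : ℝ, (Lfam L0 L1 t).charpoly =
      (Polynomial.X ^ 2 - Polynomial.C 3) ^ m *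
        (Polynomial.X ^ 2 - Polynomial.C (1 / 3 : ℝ)) ^ m * Polynomial.X ^ m) :
    [ (∀ t : ℝ, LinearMap.ker (Lfam L0 L1 t).mulVecLin =
        LinearMap.ker (Lfam L0 L1 0).mulVecLin),
      Module.finrank ℝ (Espan L0 L1) = m,
      (∀ t : ℝ, ∀ x ∈ Espan L0 L1, (Lfam L0 L1 t).mulVec x = 0),
      (∀ x ∈ EspanC L0 L1, (Lplus L0 L1).mulVec x = 0),
      (Lplus L0 L1 * Pmfour L0 L1 = 0 ∧ Lplus L0 L1 * Pmtwo L0 L1 = 0 ∧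
        Lplus L0 L1 * Pzero L0 L1 = 0 ∧ Lplus L0 L1 * Ptwo L0 L1 = 0 ∧
        Lplus L0 L1 * Pfour L0 L1 = 0) ].TFAE := by
  have hsymm := isSymm_Lfam h0 h1
  have hproj : ∀ t, Lfam L0 L1 t * kerProj (Lfam L0 L1 t) = 0 := fun t =>
    mul_kerProj_eq_zero (hsymm t) (hiso t)
  have hdim : ∀ t, Module.finrank ℝ (LinearMap.ker (Lfam L0 L1 t).mulVecLin) = m := fun t => by
    rw [finrank_ker_eq_rootMultiplicity (hsymm t), hiso t, rootMultiplicity_zero_charpoly]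
  tfae_have 1 → 2 := by
    intro h
    have hE : Espan L0 L1 = LinearMap.ker (Lfam L0 L1 0).mulVecLin :=
      le_antisymm (iSup_le fun t => (h t).le) (ker_Lfam_le_Espan 0)
    rw [hE, hdim]
  tfae_have 2 → 3 := by
    intro h t x hx
    rw [← Submodule.eq_of_le_of_finrank_eq (ker_Lfam_le_Espan t) ((hdim t).trans h.symm)] at hx
    exact hx
  tfae_have 3 → 1 := by
    intro h t
    have hE : ∀ s, LinearMap.ker (Lfam L0 L1 s).mulVecLin = Espan L0 L1 := fun s =>
      le_antisymm (ker_Lfam_le_Espan s) fun x hx => h s x hx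
    rw [hE t, hE 0]
  tfae_have 3 ↔ 4 := by
    rw [forall_EspanC_iff]
    simp only [Lplus_mulVec_ofReal_eq_zero_iff]
    exact ⟨fun h x hx t => h t x hx, fun h t x hx => h x hx t⟩
  tfae_have 4 ↔ 5 := by
    rw [forall_EspanC_iff, forall_Espan_mulVec_iff hproj, mul_coeffs_eq_zero_iff]
  tfae_finish

end
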